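/- arXiv:2512.01475 — 4 statements merged into one kernel-verified Lean document; each statement's English description precedes it below -/
import Mathlib

section
/- (Willems' fundamental lemma, generalized form.) Let A ∈ ℝ^{n_x×n_x}, B ∈ ℝ^{n_x×n_u}, C ∈ ℝ^{n_y×n_x}, D ∈ ℝ^{n_y×n_u}, L ≥ 1, and let H⁰ ∈ ℝ^{(n_u+n_y)L×M} be a matrix each of whose columns is a stacked length-L trajectory of (A,B,C,D). Suppose rank(H⁰) = n_u·L + n_x. Then a vector z ∈ ℝ^{(n_u+n_y)L} is a stacked length-L trajectory of (A,B,C,D) if and only if there exists g ∈ ℝ^M such that z = H⁰ g. -/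
/-- `z : Fin L × (Fin nu ⊕ Fin ny) → ℝ` is a stacked length-`L` input-output trajectory of
the LTI system `(A, B, C, D)`. -/
def IsTrajectory {nx nu ny L : ℕ}
    (A : Matrix (Fin nx) (Fin nx) ℝ) (B : Matrix (Fin nx) (Fin nu) ℝ)
    (C : Matrix (Fin ny) (Fin nx) ℝ) (D : Matrix (Fin ny) (Fin nu) ℝ)
    (z : Fin L × (Fin nu ⊕ Fin ny) → ℝ) : Prop :=
  ∃ x : Fin L → Fin nx → ℝ,
    (∀ t : Fin L, ∀ ht : (t : ℕ) + 1 < L,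
      x ⟨(t : ℕ) + 1, ht⟩ =
        A.mulVec (x t) + B.mulVec (fun i => z (t, Sum.inl i))) ∧
    (∀ t : Fin L, (fun j => z (t, Sum.inr j)) =
        C.mulVec (x t) + D.mulVec (fun i => z (t, Sum.inl i)))

open Module

/-- The state-trajectory pairs `(x, z)` of the system `(A, B, C, D)` over a horizon of length `L`. -/
def stateTrajectory {nx nu ny : ℕ} (L : ℕ)
    (A : Matrix (Fin nx) (Fin nx) ℝ) (B : Matrix (Fin nx) (Fin nu) ℝ)
    (C : Matrix (Fin ny) (Fin nx) ℝ) (D : Matrix (Fin ny) (Fin nu) ℝ) :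
    Submodule ℝ ((Fin L → Fin nx → ℝ) × (Fin L × (Fin nu ⊕ Fin ny) → ℝ)) where
  carrier := {p |
    (∀ t : Fin L, ∀ ht : (t : ℕ) + 1 < L,
      p.1 ⟨(t : ℕ) + 1, ht⟩ =
        A.mulVec (p.1 t) + B.mulVec (fun i => p.2 (t, Sum.inl i))) ∧
    (∀ t : Fin L, (fun j => p.2 (t, Sum.inr j)) =
        C.mulVec (p.1 t) + D.mulVec (fun i => p.2 (t, Sum.inl i)))}
  zero_mem' := by
    have h : (fun _ : Fin nu => (0 : ℝ)) = 0 := rfl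
    have h' : (fun _ : Fin ny => (0 : ℝ)) = 0 := rfl
    simp [h, h']
  add_mem' := by
    rintro p q ⟨hp, hp'⟩ ⟨hq, hq'⟩
    have h (t : Fin L) : (fun i : Fin nu => (p + q).2 (t, Sum.inl i)) =
        (fun i => p.2 (t, Sum.inl i)) + fun i => q.2 (t, Sum.inl i) := rfl
    have h' (t : Fin L) : (fun j : Fin ny => (p + q).2 (t, Sum.inr j)) =
        (fun j => p.2 (t, Sum.inr j)) + fun j => q.2 (t, Sum.inr j) := rfl
    refine ⟨fun t ht => ?_, fun t => ?_⟩
    · rw [h, Prod.fst_add, Pi.add_apply, Pi.add_apply, hp t ht, hq t ht,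
        Matrix.mulVec_add, Matrix.mulVec_add]
      abel
    · rw [h, h', Prod.fst_add, Pi.add_apply, hp' t, hq' t, Matrix.mulVec_add, Matrix.mulVec_add]
      abel
  smul_mem' := by
    rintro c p ⟨hp, hp'⟩
    have h (t : Fin L) : (fun i : Fin nu => (c • p).2 (t, Sum.inl i)) =
        c • fun i => p.2 (t, Sum.inl i) := rfl
    have h' (t : Fin L) : (fun j : Fin ny => (c • p).2 (t, Sum.inr j)) =
        c • fun j => p.2 (t, Sum.inr j) := rfl
    refine ⟨fun t ht => ?_, fun t => ?_⟩
    · rw [h, Prod.smul_fst, Pi.smul_apply, Pi.smul_apply, hp t ht,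
        Matrix.mulVec_smul, Matrix.mulVec_smul, smul_add]
    · rw [h, h', Prod.smul_fst, Pi.smul_apply, hp' t, Matrix.mulVec_smul, Matrix.mulVec_smul,
        smul_add]

/-- A state-trajectory pair is determined by its initial state and its inputs. -/
theorem stateTrajectory_eq_zero {nx nu ny L : ℕ} (hL : 0 < L)
    {A : Matrix (Fin nx) (Fin nx) ℝ} {B : Matrix (Fin nx) (Fin nu) ℝ}
    {C : Matrix (Fin ny) (Fin nx) ℝ} {D : Matrix (Fin ny) (Fin nu) ℝ}
    {p : (Fin L → Fin nx → ℝ) × (Fin L × (Fin nu ⊕ Fin ny) → ℝ)}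
    (hp : p ∈ stateTrajectory L A B C D) (hx : p.1 ⟨0, hL⟩ = 0)
    (hu : ∀ t i, p.2 (t, Sum.inl i) = 0) : p = 0 := by
  obtain ⟨hstate, hout⟩ := hp
  have hu' (t : Fin L) : (fun i => p.2 (t, Sum.inl i)) = 0 := funext (hu t)
  have hx' : ∀ (k : ℕ) (hk : k < L), p.1 ⟨k, hk⟩ = 0 := by
    intro k
    induction k with
    | zero => exact fun _ => hx
    | succ k ih =>
      intro hk
      simpa [hu', ih (by lia)] using hstate ⟨k, by lia⟩ hk
  refine Prod.ext (funext fun t => hx' t t.2) (funext ?_)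
  rintro ⟨t, i | j⟩
  · exact hu t i
  · have h := congrFun (hout t) j
    simpa [hu', hx' t t.2] using h

theorem finrank_stateTrajectory_le {nx nu ny L : ℕ} (hL : 0 < L)
    (A : Matrix (Fin nx) (Fin nx) ℝ) (B : Matrix (Fin nx) (Fin nu) ℝ)
    (C : Matrix (Fin ny) (Fin nx) ℝ) (D : Matrix (Fin ny) (Fin nu) ℝ) :
    finrank ℝ (stateTrajectory L A B C D) ≤ nu * L + nx := by
  let initialStateAndInputs : stateTrajectory L A B C D →ₗ[ℝ]
      (Fin nx → ℝ) × (Fin L × Fin nu → ℝ) :=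
    { toFun p := (p.1.1 ⟨0, hL⟩, fun k => p.1.2 (k.1, Sum.inl k.2))
      map_add' _ _ := rfl
      map_smul' _ _ := rfl }
  have hinj : Function.Injective initialStateAndInputs := by
    rw [injective_iff_map_eq_zero]
    intro p hp
    obtain ⟨hx, hu⟩ := Prod.ext_iff.1 hp
    exact Subtype.ext (stateTrajectory_eq_zero hL p.2 hx fun t i => congrFun hu (t, i))
  calc finrank ℝ (stateTrajectory L A B C D)
      ≤ finrank ℝ ((Fin nx → ℝ) × (Fin L × Fin nu → ℝ)) :=
        LinearMap.finrank_le_finrank_of_injective hinj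
    _ = nu * L + nx := by
        simp [Module.finrank_prod, mul_comm, add_comm]

/-- The subspace of stacked length-`L` trajectories of `(A, B, C, D)`. -/
def trajectorySubmodule {nx nu ny : ℕ} (L : ℕ)
    (A : Matrix (Fin nx) (Fin nx) ℝ) (B : Matrix (Fin nx) (Fin nu) ℝ)
    (C : Matrix (Fin ny) (Fin nx) ℝ) (D : Matrix (Fin ny) (Fin nu) ℝ) :
    Submodule ℝ (Fin L × (Fin nu ⊕ Fin ny) → ℝ) :=
  (stateTrajectory L A B C D).map (LinearMap.snd ℝ _ _)

theorem mem_trajectorySubmodule {nx nu ny L : ℕ}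
    {A : Matrix (Fin nx) (Fin nx) ℝ} {B : Matrix (Fin nx) (Fin nu) ℝ}
    {C : Matrix (Fin ny) (Fin nx) ℝ} {D : Matrix (Fin ny) (Fin nu) ℝ}
    {z : Fin L × (Fin nu ⊕ Fin ny) → ℝ} :
    z ∈ trajectorySubmodule L A B C D ↔ IsTrajectory A B C D z := by
  constructor
  · rintro ⟨⟨x, _⟩, hx, rfl⟩
    exact ⟨x, hx⟩
  · rintro ⟨x, hx⟩
    exact ⟨(x, z), hx, rfl⟩

theorem finrank_trajectorySubmodule_le {nx nu ny L : ℕ} (hL : 0 < L)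
    (A : Matrix (Fin nx) (Fin nx) ℝ) (B : Matrix (Fin nx) (Fin nu) ℝ)
    (C : Matrix (Fin ny) (Fin nx) ℝ) (D : Matrix (Fin ny) (Fin nu) ℝ) :
    finrank ℝ (trajectorySubmodule L A B C D) ≤ nu * L + nx :=
  (Submodule.finrank_map_le _ _).trans (finrank_stateTrajectory_le hL A B C D)

/-- Willems' fundamental lemma (generalized form): if each column of `H0` is a stacked
length-`L` trajectory of `(A,B,C,D)` and `rank H0 = nu * L + nx`, then `z` is a stacked
length-`L` trajectory iff `z = H0 g` for some `g`. -/
theorem willems_fundamental_lemma {nx nu ny L M : ℕ} (hL : 1 ≤ L)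
    (A : Matrix (Fin nx) (Fin nx) ℝ) (B : Matrix (Fin nx) (Fin nu) ℝ)
    (C : Matrix (Fin ny) (Fin nx) ℝ) (D : Matrix (Fin ny) (Fin nu) ℝ)
    (H0 : Matrix (Fin L × (Fin nu ⊕ Fin ny)) (Fin M) ℝ)
    (hcols : ∀ c : Fin M, IsTrajectory A B C D (fun i => H0 i c))
    (hrank : H0.rank = nu * L + nx)
    (z : Fin L × (Fin nu ⊕ Fin ny) → ℝ) :
    IsTrajectory A B C D z ↔ ∃ g : Fin M → ℝ, z = H0.mulVec g := by
  have hle : LinearMap.range H0.mulVecLin ≤ trajectorySubmodule L A B C D := by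
    rw [Matrix.range_mulVecLin, Submodule.span_le]
    rintro _ ⟨c, rfl⟩
    exact mem_trajectorySubmodule.2 (hcols c)
  have heq : LinearMap.range H0.mulVecLin = trajectorySubmodule L A B C D :=
    Submodule.eq_of_le_of_finrank_le hle
      ((finrank_trajectorySubmodule_le hL A B C D).trans_eq hrank.symm)
  rw [← mem_trajectorySubmodule, ← heq, LinearMap.mem_range]
  simp only [Matrix.mulVecLin_apply, eq_comm]
end

section
/- (Deterministic trajectory recovery.) Let A ∈ ℝ^{n_x×n_x}, B ∈ ℝ^{n_x×n_u}, C ∈ ℝ^{n_y×n_x}, D ∈ ℝ^{n_y×n_u}, L ≥ 1, and let H ∈ ℝ^{(n_u+n_y)L×M} be a matrix each of whose columns is a stacked length-L trajectory of (A,B,C,D). Let Φ ∈ ℝ^{p×(n_u+n_y)L} and suppose rank(H) = rank(Φ·H) = n_u·L + n_x. Let z⁰ be any stacked length-L trajectory of (A,B,C,D). Then there exists g ∈ ℝ^M with Φ·H·g = Φ·z⁰, and every g ∈ ℝ^M satisfying Φ·H·g = Φ·z⁰ also satisfies H·g = z⁰. -/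
/-- The submodule of state / input-output pairs satisfying the system equations over a horizon
of length `L`. -/
def stateTrajectories {nx nu ny : ℕ} (L : ℕ)
    (A : Matrix (Fin nx) (Fin nx) ℝ) (B : Matrix (Fin nx) (Fin nu) ℝ)
    (C : Matrix (Fin ny) (Fin nx) ℝ) (D : Matrix (Fin ny) (Fin nu) ℝ) :
    Submodule ℝ ((Fin L → Fin nx → ℝ) × (Fin L × (Fin nu ⊕ Fin ny) → ℝ)) where
  carrier := {w |
    (∀ t : Fin L, ∀ ht : (t : ℕ) + 1 < L,
      w.1 ⟨(t : ℕ) + 1, ht⟩ =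
        A.mulVec (w.1 t) + B.mulVec (fun i => w.2 (t, Sum.inl i))) ∧
    (∀ t : Fin L, (fun j => w.2 (t, Sum.inr j)) =
        C.mulVec (w.1 t) + D.mulVec (fun i => w.2 (t, Sum.inl i)))}
  zero_mem' := by
    have h : (fun _ : Fin nu => (0 : ℝ)) = 0 := rfl
    have h' : (fun _ : Fin ny => (0 : ℝ)) = 0 := rfl
    simp [h, h']
  add_mem' := by
    rintro v w ⟨hv, hv'⟩ ⟨hw, hw'⟩
    have h (t : Fin L) : (fun i => (v + w).2 (t, Sum.inl i)) =
        (fun i => v.2 (t, Sum.inl i)) + fun i => w.2 (t, Sum.inl i) := rfl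
    have h' (t : Fin L) : (fun j => (v + w).2 (t, Sum.inr j)) =
        (fun j => v.2 (t, Sum.inr j)) + fun j => w.2 (t, Sum.inr j) := rfl
    refine ⟨fun t ht => ?_, fun t => ?_⟩
    · rw [h, Prod.fst_add, Pi.add_apply, Pi.add_apply, hv t ht, hw t ht, Matrix.mulVec_add,
        Matrix.mulVec_add]
      abel
    · rw [h, h', Prod.fst_add, Pi.add_apply, hv' t, hw' t, Matrix.mulVec_add, Matrix.mulVec_add]
      abel
  smul_mem' := by
    rintro c w ⟨hw, hw'⟩
    have h (t : Fin L) : (fun i => (c • w).2 (t, Sum.inl i)) =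
        c • fun i => w.2 (t, Sum.inl i) := rfl
    have h' (t : Fin L) : (fun j => (c • w).2 (t, Sum.inr j)) =
        c • fun j => w.2 (t, Sum.inr j) := rfl
    refine ⟨fun t ht => ?_, fun t => ?_⟩
    · rw [h, Prod.smul_fst, Pi.smul_apply, Pi.smul_apply, hw t ht, Matrix.mulVec_smul,
        Matrix.mulVec_smul, smul_add]
    · rw [h, h', Prod.smul_fst, Pi.smul_apply, hw' t, Matrix.mulVec_smul, Matrix.mulVec_smul,
        smul_add]

/-- A state trajectory with zero initial state and zero input vanishes. -/
theorem stateTrajectories_eq_zero {nx nu ny L : ℕ} (hL : 0 < L)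
    {A : Matrix (Fin nx) (Fin nx) ℝ} {B : Matrix (Fin nx) (Fin nu) ℝ}
    {C : Matrix (Fin ny) (Fin nx) ℝ} {D : Matrix (Fin ny) (Fin nu) ℝ}
    {w : (Fin L → Fin nx → ℝ) × (Fin L × (Fin nu ⊕ Fin ny) → ℝ)}
    (hw : w ∈ stateTrajectories L A B C D)
    (hx : w.1 ⟨0, hL⟩ = 0) (hu : ∀ t i, w.2 (t, Sum.inl i) = 0) : w = 0 := by
  obtain ⟨hstate, hout⟩ := hw
  have hu' (t : Fin L) : (fun i => w.2 (t, Sum.inl i)) = 0 := funext (hu t)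
  have hzero : ∀ n (hn : n < L), w.1 ⟨n, hn⟩ = 0 := by
    intro n
    induction n with
    | zero => exact fun _ => hx
    | succ n ih =>
      intro hn
      rw [hstate ⟨n, by omega⟩ hn, hu', ih, Matrix.mulVec_zero, Matrix.mulVec_zero, add_zero]
  refine Prod.ext (funext fun t => hzero t t.2) (funext ?_)
  rintro ⟨t, i | j⟩
  · exact hu t i
  · have h := hout t
    rw [hu', hzero t t.2, Matrix.mulVec_zero, Matrix.mulVec_zero, add_zero] at h
    exact congrFun h j

/-- The initial state and the inputs determine a state trajectory, which bounds the dimension of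
the space of state trajectories. -/
theorem finrank_stateTrajectories_le {nx nu ny L : ℕ} (hL : 0 < L)
    (A : Matrix (Fin nx) (Fin nx) ℝ) (B : Matrix (Fin nx) (Fin nu) ℝ)
    (C : Matrix (Fin ny) (Fin nx) ℝ) (D : Matrix (Fin ny) (Fin nu) ℝ) :
    Module.finrank ℝ (stateTrajectories L A B C D) ≤ nu * L + nx := by
  let f : ((Fin L → Fin nx → ℝ) × (Fin L × (Fin nu ⊕ Fin ny) → ℝ)) →ₗ[ℝ]
      (Fin nx → ℝ) × (Fin L × Fin nu → ℝ) :=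
    { toFun := fun w => (w.1 ⟨0, hL⟩, fun q => w.2 (q.1, Sum.inl q.2))
      map_add' := fun _ _ => rfl
      map_smul' := fun _ _ => rfl }
  have hf : Function.Injective (f.domRestrict (stateTrajectories L A B C D)) := by
    rw [← LinearMap.ker_eq_bot, LinearMap.ker_eq_bot']
    rintro ⟨w, hw⟩ h
    have hfw : f w = 0 := h
    exact Subtype.ext (stateTrajectories_eq_zero hL hw (congrArg Prod.fst hfw)
      fun t i => congrFun (congrArg Prod.snd hfw) (t, i))
  refine (LinearMap.finrank_le_finrank_of_injective hf).trans (le_of_eq ?_)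
  simp only [Module.finrank_prod, Module.finrank_fintype_fun_eq_card, Fintype.card_prod,
    Fintype.card_fin]
  ring

/-- If left multiplication by `Φ` preserves the rank of `H`, it is injective on the range
of `H`. -/
theorem Matrix.mulVec_eq_of_rank_mul_eq {K m n p : Type*} [Field K] [Fintype m] [Fintype n]
    [Fintype p] {H : Matrix m n K} {Φ : Matrix p m K} (hrank : (Φ * H).rank = H.rank)
    {g g' : n → K} (h : (Φ * H).mulVec g = (Φ * H).mulVec g') : H.mulVec g = H.mulVec g' := by
  classical
  have hle : LinearMap.ker H.mulVecLin ≤ LinearMap.ker (Φ * H).mulVecLin := by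
    rw [Matrix.mulVecLin_mul]
    exact LinearMap.ker_le_ker_comp _ _
  have h₁ := LinearMap.finrank_range_add_finrank_ker H.mulVecLin
  have h₂ := LinearMap.finrank_range_add_finrank_ker (Φ * H).mulVecLin
  rw [Matrix.rank, Matrix.rank] at hrank
  have hker := Submodule.eq_of_le_of_finrank_eq hle (by omega)
  have hmem : g - g' ∈ LinearMap.ker (Φ * H).mulVecLin := by
    rw [LinearMap.mem_ker, Matrix.mulVecLin_apply, Matrix.mulVec_sub, h, sub_self]
  rw [← hker, LinearMap.mem_ker, Matrix.mulVecLin_apply, Matrix.mulVec_sub] at hmem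
  exact sub_eq_zero.mp hmem

/-- Deterministic trajectory recovery: under the rank conditions
`rank H = rank (Φ * H) = nu * L + nx`, any stacked trajectory `z0` can be recovered as
`H g` from any solution `g` of `Φ * H * g = Φ * z0`, and such a solution exists. -/
theorem deterministic_trajectory_recovery {nx nu ny L M p : ℕ} (hL : 1 ≤ L)
    (A : Matrix (Fin nx) (Fin nx) ℝ) (B : Matrix (Fin nx) (Fin nu) ℝ)
    (C : Matrix (Fin ny) (Fin nx) ℝ) (D : Matrix (Fin ny) (Fin nu) ℝ)
    (H : Matrix (Fin L × (Fin nu ⊕ Fin ny)) (Fin M) ℝ)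
    (hcols : ∀ c : Fin M, IsTrajectory A B C D (fun i => H i c))
    (Φ : Matrix (Fin p) (Fin L × (Fin nu ⊕ Fin ny)) ℝ)
    (hrankH : H.rank = nu * L + nx)
    (hrankΦH : (Φ * H).rank = nu * L + nx)
    (z0 : Fin L × (Fin nu ⊕ Fin ny) → ℝ)
    (hz0 : IsTrajectory A B C D z0) :
    (∃ g : Fin M → ℝ, (Φ * H).mulVec g = Φ.mulVec z0) ∧
    ∀ g : Fin M → ℝ, (Φ * H).mulVec g = Φ.mulVec z0 → H.mulVec g = z0 := by
  have hT (z : Fin L × (Fin nu ⊕ Fin ny) → ℝ) (hz : IsTrajectory A B C D z) :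
      z ∈ (stateTrajectories L A B C D).map (LinearMap.snd ℝ _ _) := by
    obtain ⟨x, hx⟩ := hz
    exact ⟨(x, z), hx, rfl⟩
  have hle : LinearMap.range H.mulVecLin ≤
      (stateTrajectories L A B C D).map (LinearMap.snd ℝ _ _) := by
    rw [Matrix.range_mulVecLin, Submodule.span_le]
    rintro _ ⟨c, rfl⟩
    exact hT _ (hcols c)
  have hrange := Submodule.eq_of_le_of_finrank_le hle <|
    (Submodule.finrank_map_le _ _).trans <|
      (finrank_stateTrajectories_le hL A B C D).trans hrankH.ge
  obtain ⟨g₀, hg₀⟩ : z0 ∈ LinearMap.range H.mulVecLin := hrange ▸ hT z0 hz0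
  rw [Matrix.mulVecLin_apply] at hg₀
  have hΦ : (Φ * H).mulVec g₀ = Φ.mulVec z0 := by rw [← Matrix.mulVec_mulVec, hg₀]
  refine ⟨⟨g₀, hΦ⟩, fun g hg => ?_⟩
  rw [← hg₀]
  exact Matrix.mulVec_eq_of_rank_mul_eq (hrankΦH.trans hrankH.symm) (hg.trans hΦ.symm)
end

section
/- Let n, L, M ≥ 1, let S : ℕ → ℝ^{n×n}, let l ≥ 1 and t_k = t₀ + (k−1)·l for k ∈ {1,…,M} (arithmetic spacing; l = L gives the Page construction and l = 1 the Hankel construction). Let Σ_d and Σ_g(g) be as follows: Σ_d is the block matrix whose ((k,i),(m,j))-th n×n block is S(|t_k + i − (t_m + j)|) and Σ_g(g) := (gᵀ ⊗ I_{nL}) Σ_d (g ⊗ I_{nL}). Then for every g ∈ ℝ^M and all i, j ∈ {1,…,L}, the (i,j)-th n×n block of Σ_g(g) equals Σ_{τ=1−M}^{M−1} S(|τ·l + i − j|) · K(τ), where K(τ) := Σ_{k=1}^{M−|τ|} g_k g_{k+|τ|} is the unnormalized empirical autocorrelation of g. -/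
open Matrix
open scoped Kronecker

theorem sum_dite_shift_eq {M : ℕ} {R : Type*} [CommSemiring R] (g : Fin M → R) (d : ℕ) :
    (∑ k : Fin M, if h : (k : ℕ) + d < M then g k * g ⟨(k : ℕ) + d, h⟩ else 0) =
      ∑ k : Fin M, ∑ m : Fin M, if (m : ℕ) = k + d then g k * g m else 0 := by
  refine Finset.sum_congr rfl fun k _ => ?_
  split_ifs with h
  · rw [Finset.sum_eq_single ⟨(k : ℕ) + d, h⟩]
    · simp
    · intro m _ hm
      exact if_neg fun e => hm (Fin.ext e)
    · simp
  · refine (Finset.sum_eq_zero fun m _ => if_neg fun e => h ?_).symm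
    omega

theorem autocorrelation_eq_sum_sub_eq {M : ℕ} {R : Type*} [CommSemiring R] (g : Fin M → R)
    (τ : ℤ) :
    (∑ k : Fin M, if h : (k : ℕ) + τ.natAbs < M then
        g k * g ⟨(k : ℕ) + τ.natAbs, h⟩ else 0) =
      ∑ k : Fin M, ∑ m : Fin M, if (k : ℤ) - m = τ then g k * g m else 0 := by
  rw [sum_dite_shift_eq]
  rcases le_total 0 τ with hτ | hτ
  · rw [Finset.sum_comm]
    refine Finset.sum_congr rfl fun k _ => Finset.sum_congr rfl fun m _ => ?_
    rw [mul_comm (g m)]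
    exact if_congr (by omega) rfl rfl
  · refine Finset.sum_congr rfl fun k _ => Finset.sum_congr rfl fun m _ => ?_
    exact if_congr (by omega) rfl rfl

/-- A Toeplitz quadratic form, grouped along diagonals. -/
theorem sum_mul_toeplitz_eq {M : ℕ} {R : Type*} [CommSemiring R] (g : Fin M → R) (F : ℤ → R) :
    ∑ k : Fin M, ∑ m : Fin M, g k * g m * F ((k : ℤ) - m) =
      ∑ τ ∈ Finset.Icc (1 - (M : ℤ)) ((M : ℤ) - 1),
        F τ * (∑ k : Fin M, if h : (k : ℕ) + τ.natAbs < M then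
          g k * g ⟨(k : ℕ) + τ.natAbs, h⟩ else 0) := by
  simp_rw [autocorrelation_eq_sum_sub_eq, Finset.mul_sum]
  rw [Finset.sum_comm (s := Finset.Icc _ _)]
  refine Finset.sum_congr rfl fun k _ => ?_
  rw [Finset.sum_comm]
  refine Finset.sum_congr rfl fun m _ => ?_
  have hmem : (k : ℤ) - m ∈ Finset.Icc (1 - (M : ℤ)) ((M : ℤ) - 1) := by
    rw [Finset.mem_Icc]
    omega
  simp only [mul_ite, mul_zero, Finset.sum_ite_eq, if_pos hmem]
  ring

/-- An entry of `(gᵀ ⊗ I) A (g ⊗ I)`. -/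
theorem kronecker_one_mul_mul_kronecker_one_apply {ι κ R : Type*} [Fintype ι] [Fintype κ]
    [DecidableEq κ] [CommSemiring R] (g : ι → R) (A : Matrix (ι × κ) (ι × κ) R) (p q : κ) :
    ((Matrix.of (fun (_ : Unit) (k : ι) => g k) ⊗ₖ (1 : Matrix κ κ R)) * A *
      (Matrix.of (fun (k : ι) (_ : Unit) => g k) ⊗ₖ (1 : Matrix κ κ R)))
        (Unit.unit, p) (Unit.unit, q) =
      ∑ k : ι, ∑ m : ι, g k * g m * A (k, p) (m, q) := by
  simp only [Matrix.mul_apply, Fintype.sum_prod_type, kroneckerMap_apply, Matrix.of_apply,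
    Matrix.one_apply, mul_ite, ite_mul, mul_one, mul_zero, zero_mul, Finset.sum_ite_eq,
    Finset.sum_ite_eq', Finset.mem_univ, if_true, Finset.sum_mul]
  rw [Finset.sum_comm]
  refine Finset.sum_congr rfl fun k _ => Finset.sum_congr rfl fun m _ => ?_
  ring

/-- Block formula for `Σ_g(g)` under arithmetic spacing `t_k = t₀ + (k−1)·l` (Page
construction for `l = L`, Hankel construction for `l = 1`): the `(i,j)`-th `n × n` block
equals `Σ_{τ=1−M}^{M−1} S(|τ·l + i − j|) K(τ)` where `K(τ) = Σ_{k=1}^{M−|τ|} g_k g_{k+|τ|}`. -/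
theorem sigma_g_block_formula_page_hankel {n L M : ℕ} (hn : 1 ≤ n) (hL : 1 ≤ L)
    (hM : 1 ≤ M) (S : ℕ → Matrix (Fin n) (Fin n) ℝ) (l t₀ : ℕ) (hl : 1 ≤ l)
    (t : Fin M → ℕ) (ht : ∀ k : Fin M, t k = t₀ + (k : ℕ) * l)
    (Sd : Matrix (Fin M × (Fin L × Fin n)) (Fin M × (Fin L × Fin n)) ℝ)
    (hSd : ∀ (k m : Fin M) (i j : Fin L) (a b : Fin n),
      Sd (k, (i, a)) (m, (j, b)) =
        S (((t k : ℤ) + i - ((t m : ℤ) + j)).natAbs) a b)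
    (g : Fin M → ℝ) (i j : Fin L) (a b : Fin n) :
    ((Matrix.of (fun (_ : Unit) (k : Fin M) => g k) ⊗ₖ
        (1 : Matrix (Fin L × Fin n) (Fin L × Fin n) ℝ)) * Sd *
      (Matrix.of (fun (k : Fin M) (_ : Unit) => g k) ⊗ₖ
        (1 : Matrix (Fin L × Fin n) (Fin L × Fin n) ℝ)))
        (Unit.unit, (i, a)) (Unit.unit, (j, b)) =
      ∑ τ ∈ Finset.Icc (1 - (M : ℤ)) ((M : ℤ) - 1),
        S ((τ * l + (i : ℤ) - j).natAbs) a b *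
          (∑ k : Fin M, if h : (k : ℕ) + τ.natAbs < M then
            g k * g ⟨(k : ℕ) + τ.natAbs, h⟩ else 0) := by
  rw [kronecker_one_mul_mul_kronecker_one_apply,
    ← sum_mul_toeplitz_eq g fun τ => S ((τ * l + (i : ℤ) - j).natAbs) a b]
  refine Finset.sum_congr rfl fun k _ => Finset.sum_congr rfl fun m _ => ?_
  rw [hSd, ht, ht]
  have hlag : ((t₀ + (k : ℕ) * l : ℕ) : ℤ) + i - (((t₀ + (m : ℕ) * l : ℕ) : ℤ) + j) =
      ((k : ℤ) - m) * l + i - j := by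
    push_cast
    ring
  rw [hlag]
end

section
/- (Equivalence of the first SQP iterate with regularized DeePC.) Let σ_d ≥ 0, σ > 0, q > 0, r > 0, n_y, n_u, L₀, L' ≥ 1, g₀ ∈ ℝ^M, and define λ₁ := (σ_d²‖g₀‖₂² + 1/q)⁻¹, λ₂ := (σ_d²‖g₀‖₂² + σ²)⁻¹, λ₃ := n_y σ_d² (L' λ₁ + L₀ λ₂). Let Λ̄ := blkdiag(σ_d² I_{n_y(L₀+L')}, 0_{n_uL'×n_uL'}), Ψ₁ := blkdiag(λ₂⁻¹ I_{n_yL₀}, λ₁⁻¹ I_{n_yL'}, r⁻¹ I_{n_uL'}), and c̄ := tr(Λ̄ Ψ₁⁻¹). Let H_yp ∈ ℝ^{n_yL₀×M}, H_yf ∈ ℝ^{n_yL'×M}, H_uf ∈ ℝ^{n_uL'×M}, y_p ∈ ℝ^{n_yL₀}, y^ref ∈ ℝ^{n_yL'}, u^ref ∈ ℝ^{n_uL'}, and for g ∈ ℝ^M let δ(g) := col(y_p − H_yp g, y^ref − H_yf g, u^ref − H_uf g). Then c̄ = λ₃ and for every g ∈ ℝ^M: c̄‖g‖₂² + δ(g)ᵀ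 Ψ₁⁻¹ δ(g) = r‖u^ref − H_uf g‖₂² + λ₁‖y^ref − H_yf g‖₂² + λ₂‖y_p − H_yp g‖₂² + λ₃‖g‖₂². -/
open Matrix

/-- The inverse of a block-diagonal matrix with three invertible scalar blocks. -/
theorem inv_fromBlocks_smul_one {l m n K : Type*} [Fintype l] [Fintype m] [Fintype n]
    [DecidableEq l] [DecidableEq m] [DecidableEq n] [Field K] {a b c : K}
    (ha : a ≠ 0) (hb : b ≠ 0) (hc : c ≠ 0) :
    (Matrix.fromBlocks (Matrix.fromBlocks (a⁻¹ • (1 : Matrix l l K)) 0 0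
      (b⁻¹ • (1 : Matrix m m K))) 0 0 (c⁻¹ • (1 : Matrix n n K)))⁻¹ =
    Matrix.fromBlocks (Matrix.fromBlocks (a • 1) 0 0 (b • 1)) 0 0 (c • 1) := by
  apply Matrix.inv_eq_right_inv
  simp [Matrix.fromBlocks_multiply, smul_smul, ha, hb, hc, Matrix.fromBlocks_one]

/-- Equivalence of the first SQP iterate with regularized DeePC: with
`λ₁ = (σ_d²‖g₀‖₂² + 1/q)⁻¹`, `λ₂ = (σ_d²‖g₀‖₂² + σ²)⁻¹`, `λ₃ = n_y σ_d² (L' λ₁ + L₀ λ₂)`,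
`Λ̄ = blkdiag(σ_d² I_{n_y(L₀+L')}, 0)`, `Ψ₁ = blkdiag(λ₂⁻¹ I, λ₁⁻¹ I, r⁻¹ I)`, and
`c̄ = tr(Λ̄ Ψ₁⁻¹)`, one has `c̄ = λ₃` and
`c̄‖g‖₂² + δ(g)ᵀ Ψ₁⁻¹ δ(g) = r‖u^ref − H_uf g‖₂² + λ₁‖y^ref − H_yf g‖₂²
  + λ₂‖y_p − H_yp g‖₂² + λ₃‖g‖₂²` for all `g`. -/
theorem first_sqp_iterate_eq_regularized_deepc {M ny nu L₀ L' : ℕ}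
    (hny : 1 ≤ ny) (hnu : 1 ≤ nu) (hL₀ : 1 ≤ L₀) (hL' : 1 ≤ L')
    (σd σ q r : ℝ) (hσd : 0 ≤ σd) (hσ : 0 < σ) (hq : 0 < q) (hr : 0 < r)
    (g₀ : Fin M → ℝ)
    (lam1 lam2 lam3 : ℝ)
    (hlam1 : lam1 = (σd ^ 2 * (∑ k, g₀ k ^ 2) + 1 / q)⁻¹)
    (hlam2 : lam2 = (σd ^ 2 * (∑ k, g₀ k ^ 2) + σ ^ 2)⁻¹)
    (hlam3 : lam3 = (ny : ℝ) * σd ^ 2 * ((L' : ℝ) * lam1 + (L₀ : ℝ) * lam2))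
    (Lbar Psi1 :
      Matrix ((Fin (ny * L₀) ⊕ Fin (ny * L')) ⊕ Fin (nu * L'))
        ((Fin (ny * L₀) ⊕ Fin (ny * L')) ⊕ Fin (nu * L')) ℝ)
    (hLbar : Lbar = Matrix.fromBlocks
      (Matrix.fromBlocks (σd ^ 2 • 1) 0 0 (σd ^ 2 • 1)) 0 0 0)
    (hPsi1 : Psi1 = Matrix.fromBlocks
      (Matrix.fromBlocks (lam2⁻¹ • 1) 0 0 (lam1⁻¹ • 1)) 0 0 (r⁻¹ • 1))
    (cbar : ℝ) (hcbar : cbar = Matrix.trace (Lbar * Psi1⁻¹))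
    (Hyp : Matrix (Fin (ny * L₀)) (Fin M) ℝ)
    (Hyf : Matrix (Fin (ny * L')) (Fin M) ℝ)
    (Huf : Matrix (Fin (nu * L')) (Fin M) ℝ)
    (yp : Fin (ny * L₀) → ℝ) (yref : Fin (ny * L') → ℝ)
    (uref : Fin (nu * L') → ℝ) :
    cbar = lam3 ∧
    ∀ g : Fin M → ℝ,
      cbar * (∑ k, g k ^ 2) +
        (Sum.elim (Sum.elim (yp - Hyp.mulVec g) (yref - Hyf.mulVec g))
            (uref - Huf.mulVec g)) ⬝ᵥ
          Psi1⁻¹.mulVec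
            (Sum.elim (Sum.elim (yp - Hyp.mulVec g) (yref - Hyf.mulVec g))
              (uref - Huf.mulVec g)) =
      r * ((uref - Huf.mulVec g) ⬝ᵥ (uref - Huf.mulVec g)) +
        lam1 * ((yref - Hyf.mulVec g) ⬝ᵥ (yref - Hyf.mulVec g)) +
        lam2 * ((yp - Hyp.mulVec g) ⬝ᵥ (yp - Hyp.mulVec g)) +
        lam3 * (∑ k, g k ^ 2) := by
  have hS : 0 ≤ σd ^ 2 * ∑ k, g₀ k ^ 2 := by positivity
  have h1 : lam1 ≠ 0 := by rw [hlam1]; positivity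
  have h2 : lam2 ≠ 0 := by rw [hlam2]; positivity
  have hinv := hPsi1 ▸ inv_fromBlocks_smul_one (l := Fin (ny * L₀)) (m := Fin (ny * L'))
    (n := Fin (nu * L')) h2 h1 hr.ne'
  have hc : cbar = lam3 := by
    rw [hcbar, hinv, hLbar, hlam3]
    simp [Matrix.fromBlocks_multiply, Matrix.trace, smul_smul]
    ring
  refine ⟨hc, fun g => ?_⟩
  rw [hc, hinv]
  simp only [Matrix.fromBlocks_mulVec, Sum.elim_comp_inl, Sum.elim_comp_inr,
    sumElim_dotProduct_sumElim, Matrix.smul_mulVec, Matrix.one_mulVec,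
    Matrix.zero_mulVec, add_zero, zero_add, dotProduct_smul, smul_eq_mul]
  ring
end
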